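/- Let (G, L) be an instance of MLCM with no unavoidable crossings in which no line is a subpath of another, and let l1, l2 be an overlapping pair without a separator whose common subpath has the minimum number of edges among all such pairs. Then the instance obtained from (G, L) by merging l1 and l2 into the single line whose path is the union of the paths of l1 and l2 still has no pair of lines forming an unavoidable crossing. -/

import Mathlib

/-!
Core model for metro-line crossing minimization (MLCM).

An embedded graph is a symmetric loopless graph together with, for each
vertex, a list of its neighbours in clockwise order (the embedding).
A line is a simple path in the graph.  A line layout assigns to each
ordered pair `(u, v)` forming an edge the clockwise order `ord u v` in
which the lines through `{u, v}` meet the port of `u`.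
-/

structure EmbeddedGraph (V : Type) where
  adj : V → V → Prop
  symm : ∀ {u v}, adj u v → adj v u
  loopless : ∀ v, ¬ adj v v
  rot : V → List V
  rot_mem : ∀ u v, v ∈ rot u ↔ adj u v
  rot_nodup : ∀ u, (rot u).Nodup

/-- `p` is a simple path (with at least one edge) in `G`. -/
def EmbeddedGraph.IsPath {V : Type} (G : EmbeddedGraph V) (p : List V) : Prop :=
  p.Nodup ∧ 2 ≤ p.length ∧ p.Chain' G.adj

/-- An instance of MLCM: an embedded graph together with a set of lines
(indexed by `ι`), each a simple path. -/
structure MLCMInstance (V ι : Type) where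
  G : EmbeddedGraph V
  line : ι → List V
  line_path : ∀ i, G.IsPath (line i)

namespace MLCMInstance

variable {V ι : Type}

/-- Line `i` passes through the edge `{u, v}`. -/
def usesEdge (M : MLCMInstance V ι) (i : ι) (u v : V) : Prop :=
  [u, v] <:+: M.line i ∨ [v, u] <:+: M.line i

/-- `u` is a terminal (an endpoint) of line `i`. -/
def Terminal (M : MLCMInstance V ι) (i : ι) (u : V) : Prop :=
  (M.line i).head? = some u ∨ (M.line i).getLast? = some u

/-- A line layout: for each ordered pair `(u, v)`, the clockwise order
(at the port of `u`) of the lines through the edge `{u, v}`. -/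
structure Layout (M : MLCMInstance V ι) where
  ord : V → V → List ι
  nodup : ∀ u v, (ord u v).Nodup
  mem_iff : ∀ u v i, i ∈ ord u v ↔ M.usesEdge i u v

variable {M : MLCMInstance V ι}

/-- Lines `i` and `j` have an edge crossing on the edge `{u, v}`:
they appear in the same relative order in both port orders. -/
def EdgeCross (lay : M.Layout) (i j : ι) (u v : V) : Prop :=
  i ≠ j ∧ List.Sublist [i, j] (lay.ord u v) ∧ List.Sublist [i, j] (lay.ord v u)

/-- The cyclic concatenation of the port orders at `u`, following the
clockwise order of the edges incident to `u`. -/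
def cyclicAt (lay : M.Layout) (u : V) : List ι :=
  (M.G.rot u).flatMap fun w => lay.ord u w

/-- Lines `i` and `j` have a vertex crossing at `u`: they alternate
`… i … j … i … j …` in the cyclic concatenation of the port orders. -/
def VertexCross (lay : M.Layout) (i j : ι) (u : V) : Prop :=
  i ≠ j ∧ ∃ n, List.Sublist [i, j, i, j] ((cyclicAt lay u).rotate n)

/-- Lines `i` and `j` cross in the layout. -/
def Crosses (lay : M.Layout) (i j : ι) : Prop :=
  (∃ u v, EdgeCross lay i j u v ∨ EdgeCross lay j i u v) ∨
  (∃ u, VertexCross lay i j u ∨ VertexCross lay j i u)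

/-- The pair of lines `i, j` has an unavoidable crossing: the lines
cross in every line layout. -/
def Unavoidable (M : MLCMInstance V ι) (i j : ι) : Prop :=
  ∀ lay : M.Layout, Crosses lay i j

/-- A vertex crossing of `i, j` at `u` is unavoidable: it occurs in
every line layout. -/
def UnavoidableVC (M : MLCMInstance V ι) (i j : ι) (u : V) : Prop :=
  ∀ lay : M.Layout, VertexCross lay i j u ∨ VertexCross lay j i u

/-- A layout is feasible when it contains no avoidable vertex crossings. -/
def Feasible (lay : M.Layout) : Prop :=
  ∀ i j u, VertexCross lay i j u → M.UnavoidableVC i j u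

/-- A layout is crossing-free when no two lines cross in it. -/
def CrossingFree (lay : M.Layout) : Prop :=
  ∀ i j, i ≠ j → ¬ Crosses lay i j

/-- The periphery condition: at every port the lines terminating at that
vertex occupy the outermost positions of the port order. -/
def Periphery (lay : M.Layout) : Prop :=
  ∀ u v, ∃ s₁ s₂ s₃ : List ι, lay.ord u v = s₁ ++ s₂ ++ s₃ ∧
    (∀ i ∈ s₁, M.Terminal i u) ∧ (∀ i ∈ s₂, ¬ M.Terminal i u) ∧
    (∀ i ∈ s₃, M.Terminal i u)

/-- `P` occurs as a (contiguous) subpath of line `i` (in either direction). -/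
def InfixOf (M : MLCMInstance V ι) (i : ι) (P : List V) : Prop :=
  P <:+: M.line i ∨ P.reverse <:+: M.line i

/-- `P` is a common subpath (with at least one edge) of lines `i` and `j`. -/
def CommonSubpath (M : MLCMInstance V ι) (i j : ι) (P : List V) : Prop :=
  2 ≤ P.length ∧ M.InfixOf i P ∧ M.InfixOf j P

/-- `P` is the (maximal) common subpath of lines `i` and `j`. -/
def MaxCommonSubpath (M : MLCMInstance V ι) (i j : ι) (P : List V) : Prop :=
  M.CommonSubpath i j P ∧ ∀ Q, M.CommonSubpath i j Q → Q.length ≤ P.length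

/-- No line is a subpath of another line. -/
def ProperLines (M : MLCMInstance V ι) : Prop :=
  ∀ i j, i ≠ j → ¬ M.InfixOf j (M.line i)

/-- Relative to the edge directed from `u` to `v`: line `i` is above
line `j` in every crossing-free solution. -/
def MustAbove (M : MLCMInstance V ι) (i j : ι) (u v : V) : Prop :=
  ∀ lay : M.Layout, Feasible lay → CrossingFree lay → List.Sublist [i, j] (lay.ord u v)

/-- `i, j` is an overlapping pair with common subpath `P` from `u` to `v`:
`i` has its terminal at `u`, and `j` has its terminal at `v`. -/
def OverlappingPair (M : MLCMInstance V ι) (i j : ι) (P : List V) (u v : V) : Prop :=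
  i ≠ j ∧ M.MaxCommonSubpath i j P ∧ P.head? = some u ∧ P.getLast? = some v ∧
    M.Terminal i u ∧ M.Terminal j v ∧ ¬ M.Terminal i v ∧ ¬ M.Terminal j u

/-- `l` is a separator of the overlapping pair `i, j` with common subpath `P`:
on `P`, in every crossing-free solution, `l` lies between `i` and `j`. -/
def Separator (M : MLCMInstance V ι) (i j : ι) (P : List V) (l : ι) : Prop :=
  l ≠ i ∧ l ≠ j ∧ ∃ u v, [u, v] <:+: P ∧
    ((M.MustAbove i l u v ∧ M.MustAbove l j u v) ∨
     (M.MustAbove j l u v ∧ M.MustAbove l i u v))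

end MLCMInstance

namespace List

variable {α : Type*}

theorem exists_filterMap_rotate {β : Type*} (g : α → Option β) (l : List α) (n : ℕ) :
    ∃ m, (l.rotate n).filterMap g = (l.filterMap g).rotate m := by
  have h : l.filterMap g ~r (l.rotate n).filterMap g := by
    rw [rotate_eq_drop_append_take_mod, filterMap_append]
    conv_lhs => rw [← take_append_drop (n % l.length) l, filterMap_append]
    exact isRotated_append
  obtain ⟨m, hm⟩ := h
  exact ⟨m, hm.symm⟩

theorem exists_rotate_filterMap {β : Type*} (g : α → Option β) (l : List α) (m : ℕ) :
    ∃ n, (l.rotate n).filterMap g = (l.filterMap g).rotate m := by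
  have h := (take_append_drop (m % (l.filterMap g).length) (l.filterMap g)).symm
  obtain ⟨l₁, l₂, rfl, h₁, h₂⟩ := filterMap_eq_append_iff.1 h
  refine ⟨l₁.length, ?_⟩
  rw [rotate_append_length_eq, rotate_eq_drop_append_take_mod, filterMap_append, h₁, h₂]

theorem Nodup.append_cons_inj {X X' R R' : List α} {u : α} (hn : (X ++ u :: R).Nodup)
    (h : X ++ u :: R = X' ++ u :: R') : X = X' ∧ R = R' := by
  have hn' := h ▸ hn
  induction X generalizing X' with
  | nil => cases X' <;> simp_all
  | cons a X ih =>
    cases X' with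
    | nil =>
      simp only [cons_append, nil_append, cons.injEq] at h
      obtain ⟨rfl, rfl⟩ := h
      simp at hn
    | cons b X' =>
      simp only [cons_append, cons.injEq] at h
      obtain ⟨rfl, h⟩ := h
      have := ih hn.of_cons h hn'.of_cons
      simp_all

theorem pair_infix_reverse {l : List α} {x y : α} : [x, y] <:+: l.reverse ↔ [y, x] <:+: l := by
  rw [← reverse_infix]
  simp

theorem Nodup.not_pair_infix_swap {l : List α} {x y : α} (hn : l.Nodup)
    (h : [x, y] <:+: l) : ¬ [y, x] <:+: l := by
  rintro ⟨s, t, rfl⟩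
  obtain ⟨s', t', h⟩ := h
  simp only [append_assoc, cons_append, nil_append] at hn h
  have h2 : (s' ++ [x]) ++ y :: t' = s ++ y :: (x :: t) := by simpa using h
  have := (Nodup.append_cons_inj (h2 ▸ hn) h2).1
  subst this
  simp [nodup_append] at hn

theorem pair_infix_append_cons {X Y : List α} {c x y : α} :
    [x, y] <:+: X ++ c :: Y ↔ [x, y] <:+: X ++ [c] ∨ [x, y] <:+: c :: Y := by
  induction X with
  | nil =>
    simp only [nil_append, iff_or_self]
    intro h
    simpa using h.length_le
  | cons a X ih =>
    have h : [x, y] <+: a :: (X ++ c :: Y) ↔ [x, y] <+: a :: (X ++ [c]) := by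
      cases X <;> simp
    rw [cons_append, infix_cons_iff, ih, cons_append, infix_cons_iff (l₂ := X ++ [c]), h, or_assoc]

theorem eq_or_eq_of_nodup_bool {l : List Bool} (hn : l.Nodup) (ht : true ∈ l) (hf : false ∈ l) :
    l = [true, false] ∨ l = [false, true] := by
  match l with
  | [] => simp at ht
  | [a] => cases a <;> simp_all
  | [a, b] => cases a <;> cases b <;> simp_all
  | a :: b :: c :: l => cases a <;> cases b <;> cases c <;> simp_all

/-- A path having an endpoint at the first vertex of one of its subpaths `P` starts with `P`,
up to reversal. -/
theorem Nodup.exists_eq_append_of_infix {l P : List α} {u p : α} (hn : l.Nodup)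
    (hP : u :: p :: P <:+: l ∨ (u :: p :: P).reverse <:+: l)
    (hu : l.head? = some u ∨ l.getLast? = some u) :
    ∃ A, l = u :: p :: P ++ A ∨ l.reverse = u :: p :: P ++ A := by
  wlog h : u :: p :: P <:+: l generalizing l with H
  · have h' := reverse_infix.2 (hP.resolve_left h)
    rw [reverse_reverse] at h'
    obtain ⟨A, hA⟩ := H (l := l.reverse) (by simpa using hn) (Or.inl h')
      (by simpa [or_comm] using hu) h'
    exact ⟨A, by simpa [or_comm] using hA⟩
  obtain ⟨s, t, rfl⟩ := h
  refine ⟨t, Or.inl ?_⟩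
  rcases hu with hu | hu
  · cases s with
    | nil => simp
    | cons a s => simp_all
  · have hmem : u ∈ p :: P ++ t := by
      have e : s ++ u :: p :: P ++ t = (s ++ [u]) ++ (p :: P ++ t) := by simp
      rw [e, getLast?_append_of_ne_nil _ (by simp)] at hu
      exact mem_of_getLast? hu
    simp [nodup_append] at hn hmem
    grind

/-- A simple path on the union of two paths overlapping in `P` is obtained by gluing them
along `P`. -/
theorem Nodup.eq_append_of_overlap {l A B P : List α} {u p : α} (hn : l.Nodup)
    (hA : u :: p :: P ++ A <:+: l)
    (hB : B ++ u :: p :: P <:+: l ∨ B ++ u :: p :: P <:+: l.reverse)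
    (hmem : ∀ x ∈ l, x ∈ u :: p :: P ++ A ∨ x ∈ B ++ u :: p :: P) :
    l = B ++ u :: p :: P ++ A := by
  rcases hB with hB | hB
  · obtain ⟨X, Y, rfl⟩ := hA
    obtain ⟨X', Z, h⟩ := hB
    have h1 : X ++ u :: (p :: P ++ A ++ Y) = (X' ++ B) ++ u :: (p :: P ++ Z) := by
      simpa using h.symm
    obtain ⟨rfl, -⟩ := Nodup.append_cons_inj (by simpa using hn) h1
    have hX : X' = [] := by
      refine eq_nil_iff_forall_not_mem.2 fun x hx => ?_
      have := hmem x (by simp [hx])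
      simp only [nodup_append, mem_append, mem_cons] at hn this
      grind
    have hY : Y = [] := by
      refine eq_nil_iff_forall_not_mem.2 fun x hx => ?_
      have := hmem x (by simp [hx])
      simp only [nodup_append, mem_append, mem_cons] at hn this
      grind
    simp [hX, hY]
  · have h1 : [u, p] <:+: l := IsInfix.trans ⟨[], P ++ A, by simp⟩ hA
    have h2 : [u, p] <:+: l.reverse := IsInfix.trans ⟨B, P, by simp⟩ hB
    exact absurd (pair_infix_reverse.1 h2) (hn.not_pair_infix_swap h1)

/-- The path `l` passes through the edge `{x, y}`. -/
def Traverses (l : List α) (x y : α) : Prop :=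
  [x, y] <:+: l ∨ [y, x] <:+: l

theorem traverses_reverse {l : List α} {x y : α} :
    l.reverse.Traverses x y ↔ l.Traverses x y := by
  simp only [Traverses, pair_infix_reverse]
  exact or_comm

theorem traverses_append_cons {X Y : List α} {c x y : α} :
    (X ++ c :: Y).Traverses x y ↔ (X ++ [c]).Traverses x y ∨ (c :: Y).Traverses x y := by
  unfold Traverses
  rw [pair_infix_append_cons (x := x), pair_infix_append_cons (x := y)]
  tauto

theorem Traverses.mem {l : List α} {x y : α} (h : l.Traverses x y) : x ∈ l ∧ y ∈ l := by
  rcases h with h | h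
  · exact ⟨h.subset (by simp), h.subset (by simp)⟩
  · exact ⟨h.subset (by simp), h.subset (by simp)⟩

section Overlap

variable {A B P : List α} {u p x y : α}

theorem Nodup.traverses_overlap_left (hn : (B ++ u :: p :: P ++ A).Nodup) (hx : x ∈ B ++ [u]) :
    (B ++ u :: p :: P ++ A).Traverses x y ↔ (B ++ u :: p :: P).Traverses x y := by
  have e1 : B ++ u :: p :: P ++ A = (B ++ [u]) ++ p :: (P ++ A) := by simp
  have e2 : B ++ u :: p :: P = (B ++ [u]) ++ p :: P := by simp
  rw [e1] at hn ⊢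
  have h1 : x ∉ p :: (P ++ A) := fun h => (nodup_append.1 hn).2.2 x hx x h rfl
  have h2 : x ∉ p :: P := fun h => h1 (by simp at h ⊢; tauto)
  rw [e2, traverses_append_cons, traverses_append_cons (Y := P)]
  have h3 : ¬ (p :: (P ++ A)).Traverses x y := fun h => h1 h.mem.1
  have h4 : ¬ (p :: P).Traverses x y := fun h => h2 h.mem.1
  tauto

theorem traverses_overlap_right (hx : x ∉ B ++ [u]) :
    (B ++ u :: p :: P ++ A).Traverses x y ↔ (u :: p :: P ++ A).Traverses x y := by
  rw [append_assoc, cons_append, traverses_append_cons]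
  exact or_iff_right fun h => hx h.mem.1

theorem Nodup.eq_of_traverses_overlap (hn : (B ++ u :: p :: P ++ A).Nodup) (hx : x ∈ B ++ [u])
    (hy : y ∉ B ++ [u]) (h : (B ++ u :: p :: P ++ A).Traverses x y) : x = u ∧ y = p := by
  have e1 : B ++ u :: p :: P ++ A = (B ++ [u]) ++ p :: (P ++ A) := by simp
  have h1 : x ∉ p :: (P ++ A) := fun h => (nodup_append.1 (e1 ▸ hn)).2.2 x hx x h rfl
  rw [append_assoc, cons_append, traverses_append_cons] at h
  rcases h with h | h | h
  · exact absurd h.mem.2 hy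
  · rcases infix_cons_iff.1 h with h | h
    · simpa [cons_prefix_cons] using h
    · exact absurd (h.subset (by simp)) h1
  · rcases infix_cons_iff.1 h with h | h
    · simp only [cons_append, cons_prefix_cons] at h
      simp [h.1] at hy
    · exact absurd (h.subset (by simp)) h1

end Overlap

end List

/-- The relative order of `a` (`true`) and `b` (`false`) in a list. -/
def pairPattern {α : Type*} [DecidableEq α] (a b : α) (l : List α) : List Bool :=
  l.filterMap fun z => if z = a then some true else if z = b then some false else none

section PairPattern

variable {α : Type*} [DecidableEq α] {a b : α}

theorem map_sublist_iff_pairPattern (hab : a ≠ b) (bs : List Bool) (l : List α) :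
    (bs.map fun c => cond c a b).Sublist l ↔ bs.Sublist (pairPattern a b l) := by
  induction l generalizing bs with
  | nil => cases bs <;> simp [pairPattern]
  | cons z l ih =>
    unfold pairPattern at ih ⊢
    rw [List.filterMap_cons]
    cases bs with
    | nil => simp
    | cons c bs =>
      have ih1 := ih bs
      have ih2 := ih (c :: bs)
      by_cases hza : z = a
      · subst hza
        cases c <;> simp_all [List.cons_sublist_cons', Ne.symm hab]
      · by_cases hzb : z = b
        · subst hzb
          cases c <;> simp_all [List.cons_sublist_cons', Ne.symm hab]
        · cases c <;> simp_all [List.cons_sublist_cons', Ne.symm hza, Ne.symm hzb]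

theorem true_mem_pairPattern {l : List α} : true ∈ pairPattern a b l ↔ a ∈ l := by
  simp only [pairPattern, List.mem_filterMap]
  grind

theorem false_mem_pairPattern (hab : a ≠ b) {l : List α} :
    false ∈ pairPattern a b l ↔ b ∈ l := by
  simp only [pairPattern, List.mem_filterMap]
  grind

theorem nodup_pairPattern {l : List α} (hl : l.Nodup) : (pairPattern a b l).Nodup := by
  refine List.Nodup.filterMap ?_ hl
  intro x y c hx hy
  simp only [Option.mem_def] at hx hy
  grind

end PairPattern

/-- Port orders `t` of two lines, distinguished by Booleans, that force the lines to cross. -/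
def EmbeddedGraph.PatternCross {V : Type} (G : EmbeddedGraph V) (t : V → V → List Bool) : Prop :=
  (∃ (c : Bool) (x y : V), [c, !c].Sublist (t x y) ∧ [c, !c].Sublist (t y x)) ∨
  ∃ (c : Bool) (x : V) (n : ℕ), [c, !c, c, !c].Sublist (((G.rot x).flatMap (t x)).rotate n)

namespace MLCMInstance

variable {V ι : Type} {M : MLCMInstance V ι}

theorem crosses_symm {lay : M.Layout} {a b : ι} : Crosses lay a b ↔ Crosses lay b a := by
  simp only [Crosses, or_comm]

/-- The two lines of an overlapping pair and a simple path on their union, up to reversal. -/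
theorem OverlappingPair.exists_decomposition {i j : ι} {P : List V} {u v : V}
    (h : M.OverlappingPair i j P u v) {Q : List V} (hQ : Q.Nodup)
    (hQi : M.line i <:+: Q ∨ (M.line i).reverse <:+: Q)
    (hQj : M.line j <:+: Q ∨ (M.line j).reverse <:+: Q)
    (hQunion : ∀ x ∈ Q, x ∈ M.line i ∨ x ∈ M.line j) :
    ∃ (p : V) (P' A B : List V), P = u :: p :: P' ∧ (B ++ u :: p :: P' ++ A).Nodup ∧
      (∀ x y, M.usesEdge i x y ↔ (u :: p :: P' ++ A).Traverses x y) ∧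
      (∀ x y, M.usesEdge j x y ↔ (B ++ u :: p :: P').Traverses x y) ∧
      (∀ x y, Q.Traverses x y ↔ (B ++ u :: p :: P' ++ A).Traverses x y) := by
  obtain ⟨-, ⟨⟨hlen, hPi, hPj⟩, -⟩, hu, hv, hiu, hjv, -, -⟩ := h
  match P, hlen with
  | w :: p :: P', _ =>
  obtain rfl : w = u := by simpa using hu
  obtain ⟨A, hA⟩ := (M.line_path i).1.exists_eq_append_of_infix hPi hiu
  obtain ⟨B, hB⟩ : ∃ B, M.line j = B ++ w :: p :: P' ∨ (M.line j).reverse = B ++ w :: p :: P' := by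
    obtain ⟨q, r, R, hR⟩ : ∃ q r R, (w :: p :: P').reverse = q :: r :: R := by
      match hR : (w :: p :: P').reverse with
      | [] => simp at hR
      | [_] => simpa using congrArg List.length hR
      | q :: r :: R => exact ⟨q, r, R, rfl⟩
    have hR' : w :: p :: P' = (q :: r :: R).reverse := by rw [← hR, List.reverse_reverse]
    obtain rfl : q = v := by
      rw [hR'] at hv
      simpa using hv
    unfold InfixOf at hPj
    rw [hR, hR'] at hPj
    obtain ⟨B, hB⟩ := (M.line_path j).1.exists_eq_append_of_infix hPj.symm hjv
    refine ⟨B.reverse, ?_⟩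
    rw [hR', ← List.reverse_append]
    rcases hB with hB | hB
    · exact Or.inr (by rw [hB])
    · exact Or.inl (by rw [← hB, List.reverse_reverse])
  have hui : ∀ x y, M.usesEdge i x y ↔ (w :: p :: P' ++ A).Traverses x y := by
    intro x y
    rcases hA with hA | hA
    · rw [← hA]; rfl
    · rw [← hA, List.traverses_reverse]; rfl
  have huj : ∀ x y, M.usesEdge j x y ↔ (B ++ w :: p :: P').Traverses x y := by
    intro x y
    rcases hB with hB | hB
    · rw [← hB]; rfl
    · rw [← hB, List.traverses_reverse]; rfl
  have hiA : ∀ x, x ∈ M.line i ↔ x ∈ w :: p :: P' ++ A := by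
    intro x
    rcases hA with hA | hA
    · rw [← hA]
    · rw [← hA, List.mem_reverse]
  have hjB : ∀ x, x ∈ M.line j ↔ x ∈ B ++ w :: p :: P' := by
    intro x
    rcases hB with hB | hB
    · rw [← hB]
    · rw [← hB, List.mem_reverse]
  have orient : ∀ {l X : List V}, (l <:+: Q ∨ l.reverse <:+: Q) → (l = X ∨ l.reverse = X) →
      X <:+: Q ∨ X <:+: Q.reverse := by
    rintro l X (h | h) (rfl | rfl)
    · exact Or.inl h
    · exact Or.inr (List.reverse_infix.2 h)
    · exact Or.inr (by simpa using List.reverse_infix.2 h)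
    · exact Or.inl h
  have hQA := orient hQi hA
  have hQB := orient hQj hB
  have hmem : ∀ x ∈ Q, x ∈ w :: p :: P' ++ A ∨ x ∈ B ++ w :: p :: P' := fun x hx =>
    (hQunion x hx).imp (hiA x).1 (hjB x).1
  refine ⟨p, P', A, B, rfl, ?_⟩
  rcases hQA with hQA | hQA
  · have e := hQ.eq_append_of_overlap hQA hQB hmem
    exact ⟨e ▸ hQ, hui, huj, fun x y => by rw [e]⟩
  · have e := (List.nodup_reverse.2 hQ).eq_append_of_overlap hQA
      (by rw [List.reverse_reverse]; exact hQB.symm)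
      (fun x hx => hmem x (List.mem_reverse.1 hx))
    exact ⟨e ▸ List.nodup_reverse.2 hQ, hui, huj,
      fun x y => by rw [← e, List.traverses_reverse]⟩

variable [DecidableEq ι]

theorem pairPattern_cyclicAt (lay : M.Layout) (a b : ι) (x : V) :
    pairPattern a b (cyclicAt lay x) =
      (M.G.rot x).flatMap fun w => pairPattern a b (lay.ord x w) := by
  simp only [pairPattern, cyclicAt, List.filterMap_flatMap]

theorem exists_sublist_rotate_cyclicAt_iff (lay : M.Layout) {a b : ι} (hab : a ≠ b)
    (bs : List Bool) (x : V) :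
    (∃ n, (bs.map fun c => cond c a b).Sublist ((cyclicAt lay x).rotate n)) ↔
      ∃ n, bs.Sublist
        (((M.G.rot x).flatMap fun w => pairPattern a b (lay.ord x w)).rotate n) := by
  simp only [map_sublist_iff_pairPattern hab, ← pairPattern_cyclicAt]
  constructor
  · rintro ⟨n, hn⟩
    obtain ⟨m, hm⟩ := List.exists_filterMap_rotate
      (fun z => if z = a then some true else if z = b then some false else none)
      (cyclicAt lay x) n
    exact ⟨m, hm ▸ hn⟩
  · rintro ⟨n, hn⟩
    obtain ⟨m, hm⟩ := List.exists_rotate_filterMap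
      (fun z => if z = a then some true else if z = b then some false else none)
      (cyclicAt lay x) n
    exact ⟨m, by rwa [pairPattern, hm]⟩

theorem crosses_iff_patternCross (lay : M.Layout) {a b : ι} (hab : a ≠ b) :
    Crosses lay a b ↔ M.G.PatternCross fun x y => pairPattern a b (lay.ord x y) := by
  have h1 := map_sublist_iff_pairPattern hab [true, false]
  have h2 := map_sublist_iff_pairPattern hab [false, true]
  have h3 := exists_sublist_rotate_cyclicAt_iff lay hab [true, false, true, false]
  have h4 := exists_sublist_rotate_cyclicAt_iff lay hab [false, true, false, true]
  simp only [List.map_cons, List.map_nil, cond_true, cond_false] at h1 h2 h3 h4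
  simp only [Crosses, EdgeCross, VertexCross, EmbeddedGraph.PatternCross, Bool.exists_bool,
    Bool.not_true, Bool.not_false, h1, h2, h3, h4, ne_eq, hab, Ne.symm hab, not_false_eq_true,
    true_and, exists_or]
  exact or_congr or_comm or_comm

/-- The relative order of two lines at all ports can be prescribed arbitrarily. -/
theorem exists_layout_pairPattern [Fintype ι] (M : MLCMInstance V ι) {a b : ι} (hab : a ≠ b)
    (t : V → V → List Bool) (ht : ∀ x y, (t x y).Nodup)
    (hta : ∀ x y, true ∈ t x y ↔ M.usesEdge a x y)
    (htb : ∀ x y, false ∈ t x y ↔ M.usesEdge b x y) :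
    ∃ lay : M.Layout, ∀ x y, pairPattern a b (lay.ord x y) = t x y := by
  classical
  let r (x y : V) : List ι :=
    (Finset.univ.filter fun k => k ≠ a ∧ k ≠ b ∧ M.usesEdge k x y).toList
  have hinj : Function.Injective fun c : Bool => cond c a b := by
    intro c d h
    cases c <;> cases d <;> simp_all
  refine ⟨⟨fun x y => (t x y).map (fun c => cond c a b) ++ r x y, ?_, ?_⟩, ?_⟩
  · intro x y
    refine List.nodup_append.2 ⟨(ht x y).map hinj, Finset.nodup_toList _, ?_⟩
    rintro z hz w hw rfl
    simp only [List.mem_map, r, Finset.mem_toList, Finset.mem_filter] at hz hw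
    obtain ⟨c, -, rfl⟩ := hz
    cases c <;> simp at hw
  · intro x y k
    have h1 := hta x y
    have h2 := htb x y
    simp only [List.mem_append, List.mem_map, Bool.exists_bool, cond_true, cond_false, r,
      Finset.mem_toList, Finset.mem_filter, Finset.mem_univ, true_and]
    grind
  · intro x y
    have h1 : pairPattern a b (r x y) = [] := by
      refine List.filterMap_eq_nil_iff.2 fun z hz => ?_
      simp only [r, Finset.mem_toList, Finset.mem_filter] at hz
      simp [hz.2.1, hz.2.2.1]
    have h2 : pairPattern a b ((t x y).map fun c => cond c a b) = t x y := by
      unfold pairPattern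
      rw [List.filterMap_map]
      conv_rhs => rw [← List.filterMap_some (l := t x y)]
      congr 1
      funext c
      cases c <;> simp [Ne.symm hab]
    unfold pairPattern at h1 h2 ⊢
    rw [List.filterMap_append, h1, h2, List.append_nil]

theorem true_mem_pairPattern_ord (lay : M.Layout) {a b : ι} {x y : V} :
    true ∈ pairPattern a b (lay.ord x y) ↔ M.usesEdge a x y :=
  true_mem_pairPattern.trans (lay.mem_iff x y a)

theorem false_mem_pairPattern_ord (lay : M.Layout) {a b : ι} (hab : a ≠ b) {x y : V} :
    false ∈ pairPattern a b (lay.ord x y) ↔ M.usesEdge b x y :=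
  (false_mem_pairPattern hab).trans (lay.mem_iff x y b)

/-- If a line `k` sharing an edge with `i` and with `j` is not forced to lie between them on that
edge, then it can be laid out without crossings on the same side of both. -/
theorem exists_layouts_pairPattern_eq {i j k : ι} {P : List V} {u p : V}
    (hik : ¬ M.Unavoidable i k) (hjk : ¬ M.Unavoidable j k) (hki : k ≠ i) (hkj : k ≠ j)
    (hsep : ¬ M.Separator i j P k) (hP : [u, p] <:+: P)
    (hi : M.usesEdge i u p) (hj : M.usesEdge j u p) :
    ∃ lay₁ lay₂ : M.Layout, ¬ Crosses lay₁ i k ∧ ¬ Crosses lay₂ j k ∧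
      (M.usesEdge k u p → pairPattern i k (lay₁.ord u p) = pairPattern j k (lay₂.ord u p)) := by
  simp only [Unavoidable, not_forall] at hik hjk
  obtain ⟨l₁, h₁⟩ := hik
  obtain ⟨l₂, h₂⟩ := hjk
  by_contra! H
  have hk := (H l₁ l₂ h₁ h₂).1
  have hpi (lay : M.Layout) := List.eq_or_eq_of_nodup_bool
    (nodup_pairPattern (a := i) (b := k) (lay.nodup u p))
    ((true_mem_pairPattern_ord lay).2 hi) ((false_mem_pairPattern_ord lay hki.symm).2 hk)
  have hpj (lay : M.Layout) := List.eq_or_eq_of_nodup_bool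
    (nodup_pairPattern (a := j) (b := k) (lay.nodup u p))
    ((true_mem_pairPattern_ord lay).2 hj) ((false_mem_pairPattern_ord lay hkj.symm).2 hk)
  have hne (lay lay' : M.Layout) (h : ¬ Crosses lay i k) (h' : ¬ Crosses lay' j k) :=
    (H lay lay' h h').2
  have sub (c : Bool) (a : ι) (hka : k ≠ a) (lay : M.Layout)
      (h : pairPattern a k (lay.ord u p) = [c, !c]) :
      ([c, !c].map fun c => cond c a k).Sublist (lay.ord u p) :=
    (map_sublist_iff_pairPattern hka.symm _ _).2 (h ▸ List.Sublist.refl _)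
  refine hsep ⟨hki, hkj, u, p, hP, ?_⟩
  rcases hpi l₁ with e | e
  · left
    have e' : pairPattern j k (l₂.ord u p) = [false, true] :=
      (hpj l₂).resolve_left fun h => hne l₁ l₂ h₁ h₂ (e.trans h.symm)
    constructor
    · intro lay _ hcf
      exact sub true i hki lay ((hpi lay).resolve_right
        fun h => hne lay l₂ (hcf i k hki.symm) h₂ (h.trans e'.symm))
    · intro lay _ hcf
      exact sub false j hkj lay ((hpj lay).resolve_left
        fun h => hne l₁ lay h₁ (hcf j k hkj.symm) (e.trans h.symm))
  · right
    have e' : pairPattern j k (l₂.ord u p) = [true, false] :=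
      (hpj l₂).resolve_right fun h => hne l₁ l₂ h₁ h₂ (e.trans h.symm)
    constructor
    · intro lay _ hcf
      exact sub true j hkj lay ((hpj lay).resolve_right
        fun h => hne l₁ lay h₁ (hcf j k hkj.symm) (e.trans h.symm))
    · intro lay _ hcf
      exact sub false i hki lay ((hpi lay).resolve_left
        fun h => hne lay l₂ (hcf i k hki.symm) h₂ (h.trans e'.symm))

theorem not_unavoidable_of_line_eq {κ : Type} [DecidableEq κ] [Fintype κ]
    {M' : MLCMInstance V κ} {a b : κ} {c d : ι} (hab : a ≠ b) (hcd : c ≠ d)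
    (hG : M'.G = M.G) (ha : M'.line a = M.line c) (hb : M'.line b = M.line d)
    (h : ¬ M.Unavoidable c d) : ¬ M'.Unavoidable a b := by
  simp only [Unavoidable, not_forall] at h
  obtain ⟨lay, hlay⟩ := h
  obtain ⟨lay', hlay'⟩ := M'.exists_layout_pairPattern hab
    (fun x y => pairPattern c d (lay.ord x y)) (fun x y => nodup_pairPattern (lay.nodup x y))
    (fun x y => by rw [true_mem_pairPattern_ord, usesEdge, usesEdge, ha])
    (fun x y => by rw [false_mem_pairPattern_ord lay hcd, usesEdge, usesEdge, hb])
  intro hun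
  have := (crosses_iff_patternCross lay' hab).1 (hun lay')
  simp only [hlay', hG] at this
  exact hlay ((crosses_iff_patternCross lay hcd).2 this)

/-- A line glued from `i` and `j` need not cross `k` if there are layouts for `i` and for `j`
which avoid crossings with `k` and which agree on the only edge leaving the part `S`. -/
theorem not_unavoidable_of_glue {κ : Type} [DecidableEq κ] [Fintype κ]
    {M' : MLCMInstance V κ} {a b : κ} {i j k : ι} (hab : a ≠ b) (hki : k ≠ i) (hkj : k ≠ j)
    (hG : M'.G = M.G) (hb : M'.line b = M.line k) {u p : V} (S : Set V)
    (hS : ∀ x y, x ∈ S → (M'.usesEdge a x y ↔ M.usesEdge j x y))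
    (hS' : ∀ x y, x ∉ S → (M'.usesEdge a x y ↔ M.usesEdge i x y))
    (hcut : ∀ x y, x ∈ S → y ∉ S → M'.usesEdge a x y → x = u ∧ y = p)
    {lay₁ lay₂ : M.Layout} (h₁ : ¬ Crosses lay₁ i k) (h₂ : ¬ Crosses lay₂ j k)
    (hagree : M.usesEdge k u p →
      pairPattern i k (lay₁.ord u p) = pairPattern j k (lay₂.ord u p)) :
    ¬ M'.Unavoidable a b := by
  classical
  have hb' : ∀ x y, M'.usesEdge b x y ↔ M.usesEdge k x y := fun x y => by
    rw [usesEdge, usesEdge, hb]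
  obtain ⟨lay', hlay'⟩ := M'.exists_layout_pairPattern hab
    (fun x y => if x ∈ S then pairPattern j k (lay₂.ord x y) else pairPattern i k (lay₁.ord x y))
    (fun x y => by
      split_ifs
      · exact nodup_pairPattern (lay₂.nodup x y)
      · exact nodup_pairPattern (lay₁.nodup x y))
    (fun x y => by
      split_ifs with hx
      · rw [true_mem_pairPattern_ord, hS x y hx]
      · rw [true_mem_pairPattern_ord, hS' x y hx])
    (fun x y => by
      split_ifs
      · rw [false_mem_pairPattern_ord lay₂ hkj.symm, hb']
      · rw [false_mem_pairPattern_ord lay₁ hki.symm, hb'])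
  rw [crosses_iff_patternCross lay₁ hki.symm] at h₁
  rw [crosses_iff_patternCross lay₂ hkj.symm] at h₂
  have mixed : ∀ (c : Bool) (x y : V), x ∈ S → y ∉ S →
      [c, !c].Sublist (pairPattern j k (lay₂.ord x y)) →
      ¬ [c, !c].Sublist (pairPattern i k (lay₁.ord y x)) := by
    intro c x y hx hy h h'
    have hc : ∀ d : Bool, d ∈ [c, !c] := by cases c <;> decide
    have hj := (true_mem_pairPattern_ord lay₂).1 (h.subset (hc true))
    have hk := (false_mem_pairPattern_ord lay₂ hkj.symm).1 (h.subset (hc false))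
    obtain ⟨rfl, rfl⟩ := hcut x y hx hy ((hS x y hx).2 hj)
    exact h₁ (Or.inl ⟨c, x, y, by beta_reduce; rwa [hagree hk], h'⟩)
  intro hun
  have hcross := (crosses_iff_patternCross lay' hab).1 (hun lay')
  simp only [hlay', hG] at hcross
  unfold EmbeddedGraph.PatternCross at hcross
  beta_reduce at hcross
  rcases hcross with ⟨c, x, y, hxy, hyx⟩ | ⟨c, x, n, h⟩
  · split_ifs at hxy hyx with hx hy hy
    · exact h₂ (Or.inl ⟨c, x, y, hxy, hyx⟩)
    · exact mixed c x y hx hy hxy hyx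
    · exact mixed c y x hy hx hyx hxy
    · exact h₁ (Or.inl ⟨c, x, y, hxy, hyx⟩)
  · split_ifs at h with hx
    · exact h₂ (Or.inr ⟨c, x, n, h⟩)
    · exact h₁ (Or.inr ⟨c, x, n, h⟩)

end MLCMInstance

open MLCMInstance in
/-- Let `(G, L)` be an instance of MLCM with no unavoidable
crossings in which no line is a subpath of another, and let `i, j` be an
overlapping pair without a separator whose common subpath has the minimum
number of edges among all such pairs.  Then the instance obtained by merging
`i` and `j` into the single line `Q` whose path is the union of the paths of
`i` and `j` still has no pair of lines forming an unavoidable crossing. -/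
theorem mlcm_merging_preserves_absence_of_unavoidable_crossings
    {V ι : Type} [DecidableEq ι] [Fintype ι] (M : MLCMInstance V ι)
    (hunav : ∀ i j : ι, i ≠ j → ¬ M.Unavoidable i j)
    (hproper : M.ProperLines)
    (i j : ι) (P : List V) (u v : V)
    (hover : M.OverlappingPair i j P u v)
    (hnosep : ∀ l, ¬ M.Separator i j P l)
    (hmin : ∀ (i' j' : ι) (P' : List V) (u' v' : V),
      M.OverlappingPair i' j' P' u' v' → (∀ l, ¬ M.Separator i' j' P' l) →
      P.length ≤ P'.length)
    -- `Q` is the union of the paths of lines `i` and `j`: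
    (Q : List V) (hQpath : M.G.IsPath Q)
    (hQi : M.line i <:+: Q ∨ (M.line i).reverse <:+: Q)
    (hQj : M.line j <:+: Q ∨ (M.line j).reverse <:+: Q)
    (hQunion : ∀ x : V, x ∈ Q ↔ (x ∈ M.line i ∨ x ∈ M.line j))
    -- `M'` is the instance obtained from `M` by merging `i` and `j` into `Q`:
    (M' : MLCMInstance V {k : ι // k ≠ j})
    (hG' : M'.G = M.G)
    (hline' : ∀ k : {k : ι // k ≠ j},
      M'.line k = if (k : ι) = i then Q else M.line k) :
    ∀ a b : {k : ι // k ≠ j}, a ≠ b → ¬ M'.Unavoidable a b := by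
  obtain ⟨p, P', A, B, rfl, hn, hi, hj, hQ⟩ :=
    hover.exists_decomposition hQpath.1 hQi hQj fun x hx => (hQunion x).1 hx
  have hij : i ≠ j := hover.1
  have key : ∀ a b : {k : ι // k ≠ j}, a ≠ b → (a : ι) = i → ¬ M'.Unavoidable a b := by
    intro a b hab ha
    have hbi : (b : ι) ≠ i := fun h => hab (Subtype.ext (ha.trans h.symm))
    have haQ : M'.line a = Q := by rw [hline', if_pos ha]
    have ha' : ∀ x y, M'.usesEdge a x y ↔ (B ++ u :: p :: P' ++ A).Traverses x y := by
      intro x y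
      rw [← hQ, usesEdge, haQ]
      rfl
    obtain ⟨lay₁, lay₂, h₁, h₂, hagree⟩ := exists_layouts_pairPattern_eq
      (hunav i b hbi.symm) (hunav j b b.2.symm) hbi b.2 (hnosep b)
      (u := u) (p := p) ⟨[], P', rfl⟩
      ((hi u p).2 (Or.inl ⟨[], P' ++ A, by simp⟩)) ((hj u p).2 (Or.inl ⟨B, P', by simp⟩))
    refine not_unavoidable_of_glue hab hbi b.2 hG' (by rw [hline', if_neg hbi])
      {x | x ∈ B ++ [u]} ?_ ?_ ?_ h₁ h₂ hagree
    · intro x y hx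
      rw [ha', hj]
      exact hn.traverses_overlap_left hx
    · intro x y hx
      rw [ha', hi]
      exact List.traverses_overlap_right hx
    · intro x y hx hy h
      exact hn.eq_of_traverses_overlap hx hy ((ha' x y).1 h)
  intro a b hab
  by_cases ha : (a : ι) = i
  · exact key a b hab ha
  by_cases hb : (b : ι) = i
  · exact fun h => key b a hab.symm hb fun lay => crosses_symm.1 (h lay)
  have hab' : (a : ι) ≠ b := fun h => hab (Subtype.ext h)
  exact not_unavoidable_of_line_eq hab hab' hG' (by rw [hline', if_neg ha])
    (by rw [hline', if_neg hb]) (hunav a b hab')
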